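/- arXiv:0901.4686 — 3 statements merged into one kernel-verified Lean document; each statement's English description precedes it below -/
import Mathlib

section
/- For all real numbers a, b > 0, the orbit of the point (a,b) under the group G_{H2} is exactly the set {(a,b), (−a,b+aτ), (aτ+bτ,−b−aτ), (−aτ−bτ,a+bτ), (b,−a−bτ), (a+bτ,−b), (−a−bτ,aτ+bτ), (b+aτ,−aτ−bτ), (−b−aτ,a), (−b,−a)}, and these ten points are pairwise distinct. -/
noncomputable section

/-- The golden ratio `τ = (1+√5)/2`, satisfying `τ² = τ + 1`. -/
def τ : ℝ := (1 + Real.sqrt 5) / 2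

/-- The first simple reflection in the ω-basis. -/
def f1 : (ℝ × ℝ) →ₗ[ℝ] (ℝ × ℝ) where
  toFun p := (-p.1, τ * p.1 + p.2)
  map_add' p q := by apply Prod.ext <;> simp <;> ring
  map_smul' c p := by apply Prod.ext <;> simp <;> ring

/-- The second simple reflection in the ω-basis. -/
def f2 : (ℝ × ℝ) →ₗ[ℝ] (ℝ × ℝ) where
  toFun p := (p.1 + τ * p.2, -p.2)
  map_add' p q := by apply Prod.ext <;> simp <;> ring
  map_smul' c p := by apply Prod.ext <;> simp <;> ring

def r1 : (ℝ × ℝ) ≃ₗ[ℝ] (ℝ × ℝ) :=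
  LinearEquiv.ofLinear f1 f1
    (by apply LinearMap.ext; intro p; apply Prod.ext <;> simp [f1] <;> ring)
    (by apply LinearMap.ext; intro p; apply Prod.ext <;> simp [f1] <;> ring)

def r2 : (ℝ × ℝ) ≃ₗ[ℝ] (ℝ × ℝ) :=
  LinearEquiv.ofLinear f2 f2
    (by apply LinearMap.ext; intro p; apply Prod.ext <;> simp [f2] <;> ring)
    (by apply LinearMap.ext; intro p; apply Prod.ext <;> simp [f2] <;> ring)

/-- The Coxeter group, as the group of linear automorphisms of `ℝ²`
generated by the two simple reflections. -/
def GH2 : Subgroup ((ℝ × ℝ) ≃ₗ[ℝ] (ℝ × ℝ)) := Subgroup.closure {r1, r2}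

theorem τ_mul_self : τ * τ = τ + 1 := by
  have h : Real.sqrt 5 * Real.sqrt 5 = 5 := Real.mul_self_sqrt (by norm_num)
  unfold τ
  linarith

theorem one_lt_τ : 1 < τ := by
  have h : 1 < Real.sqrt 5 := Real.lt_sqrt_of_sq_lt (by norm_num)
  unfold τ
  linarith

theorem r1_apply (x y : ℝ) : r1 (x, y) = (-x, τ * x + y) := rfl

theorem r2_apply (x y : ℝ) : r2 (x, y) = (x + τ * y, -y) := rfl

theorem r1_r1 (p : ℝ × ℝ) : r1 (r1 p) = p := r1.left_inv p

theorem r2_r2 (p : ℝ × ℝ) : r2 (r2 p) = p := r2.left_inv p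

open scoped Pointwise in
/-- A set stable under both simple reflections contains the orbits of its points. -/
theorem orbit_GH2_subset {S : Set (ℝ × ℝ)} (h1 : ∀ p ∈ S, r1 p ∈ S) (h2 : ∀ p ∈ S, r2 p ∈ S)
    {p : ℝ × ℝ} (hp : p ∈ S) : MulAction.orbit GH2 p ⊆ S := by
  have hle : GH2 ≤ MulAction.stabilizer ((ℝ × ℝ) ≃ₗ[ℝ] (ℝ × ℝ)) S := by
    refine (Subgroup.closure_le _).2 ?_
    rintro g (rfl | rfl)
    · refine MulAction.mem_stabilizer_set.2 fun x => ⟨fun h => ?_, h1 x⟩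
      simpa only [LinearEquiv.smul_def, r1_r1] using h1 _ h
    · refine MulAction.mem_stabilizer_set.2 fun x => ⟨fun h => ?_, h2 x⟩
      simpa only [LinearEquiv.smul_def, r2_r2] using h2 _ h
  rintro _ ⟨g, rfl⟩
  exact (MulAction.mem_stabilizer_set.1 (hle g.2) p).2 hp

theorem r1_mem_orbit {p q : ℝ × ℝ} (h : q ∈ MulAction.orbit GH2 p) :
    r1 q ∈ MulAction.orbit GH2 p :=
  MulAction.mem_orbit_of_mem_orbit (⟨r1, Subgroup.subset_closure (by simp)⟩ : GH2) h

theorem r2_mem_orbit {p q : ℝ × ℝ} (h : q ∈ MulAction.orbit GH2 p) :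
    r2 q ∈ MulAction.orbit GH2 p :=
  MulAction.mem_orbit_of_mem_orbit (⟨r2, Subgroup.subset_closure (by simp)⟩ : GH2) h

theorem orbit_H2_of_ab (a b : ℝ) (ha : 0 < a) (hb : 0 < b) :
    MulAction.orbit GH2 ((a, b) : ℝ × ℝ) =
      ({(a, b), (-a, b + a * τ), (a * τ + b * τ, -b - a * τ),
        (-a * τ - b * τ, a + b * τ), (b, -a - b * τ), (a + b * τ, -b),
        (-a - b * τ, a * τ + b * τ), (b + a * τ, -a * τ - b * τ),
        (-b - a * τ, a), (-b, -a)} : Set (ℝ × ℝ)) ∧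
    ([(a, b), (-a, b + a * τ), (a * τ + b * τ, -b - a * τ),
      (-a * τ - b * τ, a + b * τ), (b, -a - b * τ), (a + b * τ, -b),
      (-a - b * τ, a * τ + b * τ), (b + a * τ, -a * τ - b * τ),
      (-b - a * τ, a), (-b, -a)] : List (ℝ × ℝ)).Nodup := by
  have hτ := τ_mul_self
  have h01 : r1 (a, b) = (-a, b + a * τ) := by
    rw [r1_apply]
    ext <;> grind
  have h12 : r2 (-a, b + a * τ) = (a * τ + b * τ, -b - a * τ) := by
    rw [r2_apply]
    ext <;> grind
  have h23 : r1 (a * τ + b * τ, -b - a * τ) = (-a * τ - b * τ, a + b * τ) := by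
    rw [r1_apply]
    ext <;> grind
  have h34 : r2 (-a * τ - b * τ, a + b * τ) = (b, -a - b * τ) := by
    rw [r2_apply]
    ext <;> grind
  have h49 : r1 (b, -a - b * τ) = (-b, -a) := by
    rw [r1_apply]
    ext <;> grind
  have h05 : r2 (a, b) = (a + b * τ, -b) := by
    rw [r2_apply]
    ext <;> grind
  have h56 : r1 (a + b * τ, -b) = (-a - b * τ, a * τ + b * τ) := by
    rw [r1_apply]
    ext <;> grind
  have h67 : r2 (-a - b * τ, a * τ + b * τ) = (b + a * τ, -a * τ - b * τ) := by
    rw [r2_apply]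
    ext <;> grind
  have h78 : r1 (b + a * τ, -a * τ - b * τ) = (-b - a * τ, a) := by
    rw [r1_apply]
    ext <;> grind
  have h89 : r2 (-b - a * τ, a) = (-b, -a) := by
    rw [r2_apply]
    ext <;> grind
  refine ⟨Set.Subset.antisymm (orbit_GH2_subset ?_ ?_ (by simp)) ?_, ?_⟩
  · rintro _ (rfl | rfl | rfl | rfl | rfl | rfl | rfl | rfl | rfl | rfl)
    · rw [h01]; simp
    · rw [← h01, r1_r1]; simp
    · rw [h23]; simp
    · rw [← h23, r1_r1]; simp
    · rw [h49]; simp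
    · rw [h56]; simp
    · rw [← h56, r1_r1]; simp
    · rw [h78]; simp
    · rw [← h78, r1_r1]; simp
    · rw [← h49, r1_r1]; simp
  · rintro _ (rfl | rfl | rfl | rfl | rfl | rfl | rfl | rfl | rfl | rfl)
    · rw [h05]; simp
    · rw [h12]; simp
    · rw [← h12, r2_r2]; simp
    · rw [h34]; simp
    · rw [← h34, r2_r2]; simp
    · rw [← h05, r2_r2]; simp
    · rw [h67]; simp
    · rw [← h67, r2_r2]; simp
    · rw [h89]; simp
    · rw [← h89, r2_r2]; simp
  · have m0 := MulAction.mem_orbit_self (M := GH2) ((a, b) : ℝ × ℝ)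
    have m1 := h01 ▸ r1_mem_orbit m0
    have m2 := h12 ▸ r2_mem_orbit m1
    have m3 := h23 ▸ r1_mem_orbit m2
    have m4 := h34 ▸ r2_mem_orbit m3
    have m9 := h49 ▸ r1_mem_orbit m4
    have m5 := h05 ▸ r2_mem_orbit m0
    have m6 := h56 ▸ r1_mem_orbit m5
    have m7 := h67 ▸ r2_mem_orbit m6
    have m8 := h78 ▸ r1_mem_orbit m7
    rintro _ (rfl | rfl | rfl | rfl | rfl | rfl | rfl | rfl | rfl | rfl) <;> assumption
  · have hp : a < a * τ := lt_mul_of_one_lt_right ha one_lt_τ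
    have hq : b < b * τ := lt_mul_of_one_lt_right hb one_lt_τ
    simp only [List.nodup_cons, List.mem_cons, List.not_mem_nil, Prod.mk.injEq, neg_mul, or_false,
      not_or, not_and, not_false_eq_true, List.nodup_nil, and_true]
    generalize a * τ = p at *
    generalize b * τ = q at *
    constructorm* _ ∧ _ <;> intros <;> linarith
end
end

section
/- Let V be a finite-dimensional real inner product space and G a finite subgroup of the group of linear isometries of V whose fixed subspace is trivial (the only v ∈ V with gv = v for all g ∈ G is v = 0). Then for all λ, μ ∈ V and every vector u ∈ V, the degree-three anomaly number of the product of the orbits G(λ) and G(μ) satisfies ∑_{p ∈ G(λ)} ∑_{q ∈ G(μ)} ⟨p + q, u⟩³ = |G(μ)| · ∑_{p ∈ G(λ)} ⟨p, u⟩³ + |G(λ)| · ∑_{q ∈ G(μ)} ⟨q, u⟩³. -/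
open scoped RealInnerProductSpace

section

variable {V : Type*} [NormedAddCommGroup V] [InnerProductSpace ℝ V]

/-- The orbit of a vector under a finite group of linear isometries is finite. -/
theorem finite_isometry_orbit {G : Subgroup (V ≃ₗᵢ[ℝ] V)}
    (hG : (G : Set (V ≃ₗᵢ[ℝ] V)).Finite) (v : V) :
    {x : V | ∃ g : V ≃ₗᵢ[ℝ] V, g ∈ G ∧ g v = x}.Finite :=
  hG.image fun g : V ≃ₗᵢ[ℝ] V => g v

/-- If a group of linear isometries has no nonzero fixed vector, every finite orbit sums to zero. -/
theorem sum_isometry_orbit_eq_zero {G : Subgroup (V ≃ₗᵢ[ℝ] V)}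
    (htriv : ∀ v : V, (∀ g : V ≃ₗᵢ[ℝ] V, g ∈ G → g v = v) → v = 0) (v : V) (S : Finset V)
    (hS : ∀ x, x ∈ S ↔ ∃ g : V ≃ₗᵢ[ℝ] V, g ∈ G ∧ g v = x) :
    ∑ x ∈ S, x = 0 := by
  have maps : ∀ g ∈ G, ∀ x ∈ S, g x ∈ S := by
    intro g hg x hx
    obtain ⟨k, hk, rfl⟩ := (hS x).1 hx
    exact (hS _).2 ⟨g * k, G.mul_mem hg hk, rfl⟩
  refine htriv _ fun g hg => ?_
  rw [map_sum]
  exact Finset.sum_bij' (fun x _ => g x) (fun x _ => g⁻¹ x) (maps g hg)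
    (maps g⁻¹ (G.inv_mem hg)) (fun x _ => g.symm_apply_apply x)
    (fun x _ => g.apply_symm_apply x) fun _ _ => rfl

/-- The cubic moment of the sumset of two finite families of vectors, each with sum zero. -/
theorem sum_sum_inner_add_pow_three {S T : Finset V} (hS : ∑ p ∈ S, p = 0)
    (hT : ∑ q ∈ T, q = 0) (u : V) :
    ∑ p ∈ S, ∑ q ∈ T, ⟪p + q, u⟫ ^ 3 =
      (T.card : ℝ) * ∑ p ∈ S, ⟪p, u⟫ ^ 3 + (S.card : ℝ) * ∑ q ∈ T, ⟪q, u⟫ ^ 3 := by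
  have hS' : ∑ p ∈ S, ⟪p, u⟫ = 0 := by rw [← sum_inner, hS, inner_zero_left]
  have hT' : ∑ q ∈ T, ⟪q, u⟫ = 0 := by rw [← sum_inner, hT, inner_zero_left]
  have expand : ∀ p q : V, ⟪p + q, u⟫ ^ 3 =
      ⟪p, u⟫ ^ 3 + 3 * ⟪p, u⟫ ^ 2 * ⟪q, u⟫ + ⟪p, u⟫ * (3 * ⟪q, u⟫ ^ 2) + ⟪q, u⟫ ^ 3 := by
    intro p q
    rw [inner_add_left]
    ring
  simp only [expand, Finset.sum_add_distrib, ← Finset.mul_sum, ← Finset.sum_mul, hS', hT',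
    Finset.sum_const, nsmul_eq_mul, mul_zero, zero_mul, add_zero]

end

/-- Degree-three anomaly number of a product of two orbits of a finite group of linear
isometries with trivial fixed subspace:
`∑_{p ∈ G(λ)} ∑_{q ∈ G(μ)} ⟪p+q, u⟫³ = |G(μ)| · ∑_{p ∈ G(λ)} ⟪p,u⟫³ + |G(λ)| · ∑_{q ∈ G(μ)} ⟪q,u⟫³`. -/
theorem third_anomaly_of_product_of_orbits
    {V : Type*} [NormedAddCommGroup V] [InnerProductSpace ℝ V] [FiniteDimensional ℝ V]
    (G : Subgroup (V ≃ₗᵢ[ℝ] V)) (hG : (G : Set (V ≃ₗᵢ[ℝ] V)).Finite)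
    (htriv : ∀ v : V, (∀ g : V ≃ₗᵢ[ℝ] V, g ∈ G → g v = v) → v = 0)
    (lam mu u : V) :
    (∑ᶠ p ∈ {x : V | ∃ g : V ≃ₗᵢ[ℝ] V, g ∈ G ∧ g lam = x},
      ∑ᶠ q ∈ {x : V | ∃ g : V ≃ₗᵢ[ℝ] V, g ∈ G ∧ g mu = x}, ⟪p + q, u⟫ ^ 3) =
      ({x : V | ∃ g : V ≃ₗᵢ[ℝ] V, g ∈ G ∧ g mu = x}.ncard : ℝ) *
        (∑ᶠ p ∈ {x : V | ∃ g : V ≃ₗᵢ[ℝ] V, g ∈ G ∧ g lam = x}, ⟪p, u⟫ ^ 3) +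
      ({x : V | ∃ g : V ≃ₗᵢ[ℝ] V, g ∈ G ∧ g lam = x}.ncard : ℝ) *
        (∑ᶠ q ∈ {x : V | ∃ g : V ≃ₗᵢ[ℝ] V, g ∈ G ∧ g mu = x}, ⟪q, u⟫ ^ 3) := by
  have hlam := finite_isometry_orbit hG lam
  have hmu := finite_isometry_orbit hG mu
  simp only [finsum_mem_eq_finite_toFinset_sum _ hlam, finsum_mem_eq_finite_toFinset_sum _ hmu,
    Set.ncard_eq_toFinset_card _ hlam, Set.ncard_eq_toFinset_card _ hmu]
  exact sum_sum_inner_add_pow_three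
    (sum_isometry_orbit_eq_zero htriv lam _ fun _ => hlam.mem_toFinset)
    (sum_isometry_orbit_eq_zero htriv mu _ fun _ => hmu.mem_toFinset) u
end

section
/- Let V be a real inner product space of finite dimension n ≥ 1 and G a finite subgroup of the group of linear isometries of V acting irreducibly (the only G-invariant linear subspaces of V are {0} and V) and with trivial fixed subspace (the only v ∈ V with gv = v for all g ∈ G is v = 0). Then for all λ, μ ∈ V, the fourth index of the product of the orbits G(λ) and G(μ) satisfies ∑_{p ∈ G(λ)} ∑_{q ∈ G(μ)} ‖p + q‖⁴ = |G(λ)| · |G(μ)| · ( ‖λ‖⁴ + (2(n+2)/n) · ‖λ‖² · ‖μ‖² + ‖μ‖⁴ ). -/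
open scoped RealInnerProductSpace

section InvariantFinset

variable {V : Type*} [NormedAddCommGroup V] [InnerProductSpace ℝ V]
  {G : Subgroup (V ≃ₗᵢ[ℝ] V)} {S : Finset V}

/-- Summation over a `G`-invariant finite set is unchanged by substituting `g ∈ G`. -/
theorem sum_comp_of_invariant {M : Type*} [AddCommMonoid M]
    (hS : ∀ g ∈ G, ∀ x ∈ S, g x ∈ S) {g : V ≃ₗᵢ[ℝ] V} (hg : g ∈ G) (f : V → M) :
    ∑ q ∈ S, f (g q) = ∑ q ∈ S, f q :=
  Finset.sum_nbij' g g.symm (hS g hg) (hS g⁻¹ (G.inv_mem hg)) (by simp) (by simp) (by simp)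

/-- The sum of a `G`-invariant finite set vanishes if `0` is the only vector fixed by `G`. -/
theorem sum_eq_zero_of_invariant
    (htriv : ∀ v : V, (∀ g : V ≃ₗᵢ[ℝ] V, g ∈ G → g v = v) → v = 0)
    (hS : ∀ g ∈ G, ∀ x ∈ S, g x ∈ S) : ∑ q ∈ S, q = 0 :=
  htriv _ fun g hg => by
    rw [map_sum]
    exact sum_comp_of_invariant hS hg id

/-- The frame operator `x ↦ ∑ q ∈ S, ⟪q, x⟫ • q` of a finite set of vectors. -/
noncomputable def frameOperator (S : Finset V) : V →ₗ[ℝ] V :=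
  ∑ q ∈ S, (innerₛₗ ℝ q).smulRight q

theorem frameOperator_apply (S : Finset V) (x : V) :
    frameOperator S x = ∑ q ∈ S, ⟪q, x⟫ • q := by
  simp [frameOperator]

theorem inner_frameOperator (S : Finset V) (x y : V) :
    ⟪frameOperator S x, y⟫ = ∑ q ∈ S, ⟪q, x⟫ * ⟪q, y⟫ := by
  simp [frameOperator_apply, sum_inner, real_inner_smul_left]

theorem frameOperator_isSymmetric (S : Finset V) : (frameOperator S).IsSymmetric := fun x y => by
  rw [inner_frameOperator, real_inner_comm, inner_frameOperator]
  simp only [mul_comm]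

theorem frameOperator_map_of_invariant (hS : ∀ g ∈ G, ∀ x ∈ S, g x ∈ S)
    {g : V ≃ₗᵢ[ℝ] V} (hg : g ∈ G) (x : V) :
    frameOperator S (g x) = g (frameOperator S x) := by
  rw [frameOperator_apply, frameOperator_apply, map_sum,
    ← sum_comp_of_invariant hS hg fun q => ⟪q, g x⟫ • q]
  simp

variable [FiniteDimensional ℝ V]

/-- A symmetric operator commuting with an irreducible group of isometries is a scalar. -/
theorem exists_eq_smul_of_isSymmetric_of_commute [Nontrivial V]
    (hirr : ∀ W : Submodule ℝ V,
      (∀ g : V ≃ₗᵢ[ℝ] V, g ∈ G → ∀ v ∈ W, g v ∈ W) → W = ⊥ ∨ W = ⊤)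
    {T : V →ₗ[ℝ] V} (hT : T.IsSymmetric) (hTG : ∀ g ∈ G, ∀ x, T (g x) = g (T x)) :
    ∃ c : ℝ, ∀ x, T x = c • x := by
  obtain ⟨c, hc⟩ : ∃ c : ℝ, Module.End.HasEigenvalue T c :=
    ⟨_, hT.hasEigenvalue_iSup_of_finiteDimensional⟩
  refine ⟨c, fun x => Module.End.mem_eigenspace_iff.mp ?_⟩
  rw [(hirr (Module.End.eigenspace T c) fun g hg v hv => ?_).resolve_left hc]
  · trivial
  · rw [Module.End.mem_eigenspace_iff] at hv ⊢
    rw [hTG g hg, hv, map_smul]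

/-- An invariant finite set of an irreducible group of isometries is a tight frame. -/
theorem finrank_mul_sum_inner_sq_of_invariant
    (hirr : ∀ W : Submodule ℝ V,
      (∀ g : V ≃ₗᵢ[ℝ] V, g ∈ G → ∀ v ∈ W, g v ∈ W) → W = ⊥ ∨ W = ⊤)
    (hS : ∀ g ∈ G, ∀ x ∈ S, g x ∈ S) (x : V) :
    (Module.finrank ℝ V : ℝ) * ∑ q ∈ S, ⟪x, q⟫ ^ 2 = (∑ q ∈ S, ‖q‖ ^ 2) * ‖x‖ ^ 2 := by
  cases subsingleton_or_nontrivial V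
  · simp [Subsingleton.elim x 0]
  obtain ⟨c, hc⟩ := exists_eq_smul_of_isSymmetric_of_commute hirr (frameOperator_isSymmetric S)
    fun g hg => frameOperator_map_of_invariant hS hg
  have hsq (y : V) : ∑ q ∈ S, ⟪y, q⟫ ^ 2 = c * ‖y‖ ^ 2 := by
    rw [← real_inner_self_eq_norm_sq, ← real_inner_smul_left, ← hc, inner_frameOperator]
    simp only [real_inner_comm, sq]
  have htr : ∑ q ∈ S, ‖q‖ ^ 2 = Module.finrank ℝ V * c := by
    simp_rw [← (stdOrthonormalBasis ℝ V).sum_sq_inner_right]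
    rw [Finset.sum_comm]
    simp [hsq]
  rw [hsq, htr, mul_assoc]

end InvariantFinset

/-- Fourth index of a product of two orbits of a finite, irreducibly acting group of linear
isometries of an `n`-dimensional real inner product space (`n ≥ 1`) with trivial fixed
subspace:
`∑_{p ∈ G(λ)} ∑_{q ∈ G(μ)} ‖p+q‖⁴ = |G(λ)|·|G(μ)|·(‖λ‖⁴ + (2(n+2)/n)·‖λ‖²·‖μ‖² + ‖μ‖⁴)`. -/
theorem fourth_index_of_product_of_orbits
    {V : Type*} [NormedAddCommGroup V] [InnerProductSpace ℝ V] [FiniteDimensional ℝ V]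
    (n : ℕ) (hn : 1 ≤ n) (hdim : Module.finrank ℝ V = n)
    (G : Subgroup (V ≃ₗᵢ[ℝ] V)) (hG : (G : Set (V ≃ₗᵢ[ℝ] V)).Finite)
    (hirr : ∀ W : Submodule ℝ V,
      (∀ g : V ≃ₗᵢ[ℝ] V, g ∈ G → ∀ v ∈ W, g v ∈ W) → W = ⊥ ∨ W = ⊤)
    (htriv : ∀ v : V, (∀ g : V ≃ₗᵢ[ℝ] V, g ∈ G → g v = v) → v = 0)
    (lam mu : V) :
    (∑ᶠ p ∈ {x : V | ∃ g : V ≃ₗᵢ[ℝ] V, g ∈ G ∧ g lam = x},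
      ∑ᶠ q ∈ {x : V | ∃ g : V ≃ₗᵢ[ℝ] V, g ∈ G ∧ g mu = x}, ‖p + q‖ ^ 4) =
      ({x : V | ∃ g : V ≃ₗᵢ[ℝ] V, g ∈ G ∧ g lam = x}.ncard : ℝ) *
        ({x : V | ∃ g : V ≃ₗᵢ[ℝ] V, g ∈ G ∧ g mu = x}.ncard : ℝ) *
        (‖lam‖ ^ 4 + (2 * ((n : ℝ) + 2) / (n : ℝ)) * ‖lam‖ ^ 2 * ‖mu‖ ^ 2 + ‖mu‖ ^ 4) := by
  classical
  have orbit (v : V) : ∃ S : Finset V,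
      {x : V | ∃ g : V ≃ₗᵢ[ℝ] V, g ∈ G ∧ g v = x} = ↑S ∧
      (∀ g ∈ G, ∀ x ∈ S, g x ∈ S) ∧ ∀ x ∈ S, ‖x‖ = ‖v‖ := by
    have hmem (x : V) : x ∈ hG.toFinset.image (fun g => g v) ↔ ∃ g ∈ G, g v = x := by simp
    refine ⟨hG.toFinset.image fun g => g v, ?_, fun g hg x hx => ?_, fun x hx => ?_⟩
    · ext x
      exact (hmem x).symm
    · obtain ⟨h, hh, rfl⟩ := (hmem x).mp hx
      exact (hmem _).mpr ⟨g * h, G.mul_mem hg hh, rfl⟩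
    · obtain ⟨h, -, rfl⟩ := (hmem x).mp hx
      exact h.norm_map v
  obtain ⟨A, hA, -, hAnorm⟩ := orbit lam
  obtain ⟨B, hB, hBinv, hBnorm⟩ := orbit mu
  simp only [hA, hB, finsum_mem_coe_finset, Set.ncard_coe_finset]
  have hn0 : (n : ℝ) ≠ 0 := by positivity
  have sum_norm_add (p : V) (hp : p ∈ A) : ∑ q ∈ B, ‖p + q‖ ^ 4 =
      B.card * (‖lam‖ ^ 4 + (2 * ((n : ℝ) + 2) / (n : ℝ)) * ‖lam‖ ^ 2 * ‖mu‖ ^ 2 + ‖mu‖ ^ 4) := by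
    have hlin : ∑ q ∈ B, ⟪p, q⟫ = 0 := by
      rw [← inner_sum, sum_eq_zero_of_invariant htriv hBinv, inner_zero_right]
    have hquad := finrank_mul_sum_inner_sq_of_invariant hirr hBinv p
    have hnorm : ∑ q ∈ B, ‖q‖ ^ 2 = B.card * ‖mu‖ ^ 2 := by
      rw [Finset.sum_congr rfl fun q hq => by rw [hBnorm q hq], Finset.sum_const, nsmul_eq_mul]
    rw [hdim, hnorm, hAnorm p hp] at hquad
    have hexp (q : V) (hq : q ∈ B) : ‖p + q‖ ^ 4 = (‖lam‖ ^ 2 + ‖mu‖ ^ 2) ^ 2 +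
        4 * (‖lam‖ ^ 2 + ‖mu‖ ^ 2) * ⟪p, q⟫ + 4 * ⟪p, q⟫ ^ 2 := by
      rw [show ‖p + q‖ ^ 4 = (‖p + q‖ ^ 2) ^ 2 by ring, norm_add_sq_real, hAnorm p hp, hBnorm q hq]
      ring
    rw [Finset.sum_congr rfl hexp, Finset.sum_add_distrib, Finset.sum_add_distrib,
      ← Finset.mul_sum, ← Finset.mul_sum, hlin, Finset.sum_const, nsmul_eq_mul]
    field_simp
    linear_combination 4 * hquad
  rw [Finset.sum_congr rfl sum_norm_add, Finset.sum_const, nsmul_eq_mul, ← mul_assoc]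
end
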